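/- arXiv:1905.05571 — 12 statements merged into one kernel-verified Lean document; each statement's English description precedes it below -/
import Mathlib

section
/- For all integers 1 ≤ k ≤ n, the function λ ↦ σ_k(λ)^{1/k} is concave on the open positive cone Γ₊ ⊂ ℝ^n. -/
open Finset

/-- The `k`-th elementary symmetric polynomial of `lam : Fin n → ℝ`. -/
noncomputable def esymmR (n k : ℕ) (lam : Fin n → ℝ) : ℝ :=
  ∑ s ∈ powersetCard k (univ : Finset (Fin n)), ∏ i ∈ s, lam i

theorem add_sq_div_add_le {a b c d r : ℝ} (ha : 0 < a) (hb : 0 < b) (hc : 0 < c) (hd : 0 < d)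
    (hr : c + d ≤ r) :
    (a + b) ^ 2 / (a + b + r) ≤ a ^ 2 / (a + c) + b ^ 2 / (b + d) :=
  calc (a + b) ^ 2 / (a + b + r) ≤ (a + b) ^ 2 / ((a + c) + (b + d)) := by
        apply div_le_div_of_nonneg_left <;> first | positivity | linarith
    _ ≤ a ^ 2 / (a + c) + b ^ 2 / (b + d) := by
        have h : a ^ 2 / (a + c) + b ^ 2 / (b + d) - (a + b) ^ 2 / ((a + c) + (b + d)) =
            (a * d - b * c) ^ 2 / ((a + c) * (b + d) * ((a + c) + (b + d))) := by
          field_simp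
          ring
        have h' : 0 ≤ (a * d - b * c) ^ 2 / ((a + c) * (b + d) * ((a + c) + (b + d))) := by
          positivity
        linarith

/-- Weighted geometric means of two positive reals are superadditive. -/
theorem rpow_mul_rpow_add_le {a b c d p q : ℝ} (ha : 0 < a) (hb : 0 < b) (hc : 0 < c)
    (hd : 0 < d) (hp : 0 ≤ p) (hq : 0 ≤ q) (hpq : p + q = 1) :
    a ^ p * c ^ q + b ^ p * d ^ q ≤ (a + b) ^ p * (c + d) ^ q := by
  have key : ∀ {u v : ℝ}, 0 < u → 0 < v →
      u ^ p * v ^ q ≤ (p * (u / (a + b)) + q * (v / (c + d))) * ((a + b) ^ p * (c + d) ^ q) := by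
    intro u v hu hv
    have h := Real.geom_mean_le_arith_mean2_weighted hp hq
      (show 0 ≤ u / (a + b) by positivity) (show 0 ≤ v / (c + d) by positivity) hpq
    rw [Real.div_rpow hu.le (by positivity), Real.div_rpow hv.le (by positivity),
      div_mul_div_comm, div_le_iff₀ (by positivity)] at h
    exact h
  refine (add_le_add (key ha hc) (key hb hd)).trans_eq ?_
  rw [← add_mul]
  have h : p * (a / (a + b)) + q * (c / (c + d)) + (p * (b / (a + b)) + q * (d / (c + d))) =
      p + q := by
    field_simp
    ring
  rw [h, hpq, one_mul]

section EsymmOn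

variable {ι : Type*}

/-- The `k`-th elementary symmetric polynomial in the variables `x i`, `i ∈ s`. -/
noncomputable def esymmOn (s : Finset ι) (k : ℕ) (x : ι → ℝ) : ℝ :=
  ∑ t ∈ powersetCard k s, ∏ i ∈ t, x i

@[simp]
theorem esymmOn_zero (s : Finset ι) (x : ι → ℝ) : esymmOn s 0 x = 1 := by
  simp [esymmOn]

theorem esymmOn_one (s : Finset ι) (x : ι → ℝ) : esymmOn s 1 x = ∑ i ∈ s, x i := by
  simp [esymmOn, powersetCard_one]

theorem esymmOn_pos {s : Finset ι} {k : ℕ} (hk : k ≤ #s) {x : ι → ℝ} (hx : ∀ i, 0 < x i) :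
    0 < esymmOn s k x :=
  sum_pos (fun _ _ => prod_pos fun i _ => hx i) (powersetCard_nonempty.2 hk)

theorem esymmOn_smul (s : Finset ι) (k : ℕ) (a : ℝ) (x : ι → ℝ) :
    esymmOn s k (a • x) = a ^ k * esymmOn s k x := by
  rw [esymmOn, esymmOn, mul_sum]
  refine sum_congr rfl fun t ht => ?_
  simp [prod_mul_distrib, (mem_powersetCard.1 ht).2]

theorem esymmOn_rpow_smul {s : Finset ι} {k : ℕ} (hk₀ : k ≠ 0) (hk : k ≤ #s) {a : ℝ}
    (ha : 0 ≤ a) {x : ι → ℝ} (hx : ∀ i, 0 < x i) :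
    esymmOn s k (a • x) ^ ((1 : ℝ) / k) = a * esymmOn s k x ^ ((1 : ℝ) / k) := by
  rw [esymmOn_smul, Real.mul_rpow (by positivity) (esymmOn_pos hk hx).le, one_div,
    Real.pow_rpow_inv_natCast ha hk₀]

theorem esymmOn_succ_rpow {s : Finset ι} {k : ℕ} (hk : k + 2 ≤ #s) {x : ι → ℝ}
    (hx : ∀ i, 0 < x i) :
    esymmOn s (k + 2) x ^ ((1 : ℝ) / (k + 2 : ℕ)) =
      (esymmOn s (k + 1) x ^ ((1 : ℝ) / (k + 1 : ℕ))) ^ (((k : ℝ) + 1) / (k + 2)) *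
        (esymmOn s (k + 2) x / esymmOn s (k + 1) x) ^ ((1 : ℝ) / (k + 2)) := by
  have h₁ : 0 < esymmOn s (k + 1) x := esymmOn_pos (by omega) hx
  have h₂ : 0 < esymmOn s (k + 2) x := esymmOn_pos (by omega) hx
  have hexp : (1 : ℝ) / (k + 1 : ℕ) * (((k : ℝ) + 1) / (k + 2)) = 1 / (k + 2) := by
    push_cast
    field_simp
  rw [← Real.rpow_mul h₁.le, hexp, ← Real.mul_rpow h₁.le (by positivity),
    mul_div_cancel₀ _ h₁.ne']
  push_cast
  rfl

variable [DecidableEq ι]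

theorem esymmOn_insert_succ {s : Finset ι} {a : ι} (ha : a ∉ s) (k : ℕ) (x : ι → ℝ) :
    esymmOn (insert a s) (k + 1) x = x a * esymmOn s k x + esymmOn s (k + 1) x := by
  have hnot : ∀ t ∈ powersetCard k s, a ∉ t := fun t ht h => ha ((mem_powersetCard.1 ht).1 h)
  rw [esymmOn, powersetCard_succ_insert ha, sum_union, sum_image, add_comm, esymmOn, esymmOn,
    mul_sum]
  · congr 1
    exact sum_congr rfl fun t ht => prod_insert (hnot t ht)
  · intro t ht u hu h
    rw [← erase_insert (hnot t ht), ← erase_insert (hnot u hu)]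
    exact congrArg (fun v => v.erase a) h
  · rw [disjoint_left]
    intro t ht h
    obtain ⟨u, -, rfl⟩ := mem_image.1 h
    exact ha ((mem_powersetCard.1 ht).1 (mem_insert_self a u))

theorem esymmOn_succ_of_mem {s : Finset ι} {i : ι} (hi : i ∈ s) (k : ℕ) (x : ι → ℝ) :
    esymmOn s (k + 1) x = x i * esymmOn (s.erase i) k x + esymmOn (s.erase i) (k + 1) x := by
  rw [← esymmOn_insert_succ (notMem_erase i s), insert_erase hi]

/-- The Euler identity for elementary symmetric polynomials. -/
theorem sum_mul_esymmOn_erase (s : Finset ι) (k : ℕ) (x : ι → ℝ) :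
    ∑ i ∈ s, x i * esymmOn (s.erase i) k x = (k + 1) * esymmOn s (k + 1) x := by
  induction s using Finset.induction_on generalizing k with
  | empty => simp [esymmOn, powersetCard_eq_empty.2 (show #(∅ : Finset ι) < k + 1 by simp)]
  | insert a s ha ih =>
    rw [sum_insert ha, erase_insert ha, esymmOn_insert_succ ha]
    cases k with
    | zero => simp [esymmOn_one]
    | succ k =>
      have h : ∀ i ∈ s, x i * esymmOn ((insert a s).erase i) (k + 1) x =
          x a * (x i * esymmOn (s.erase i) k x) + x i * esymmOn (s.erase i) (k + 1) x := by
        intro i hi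
        rw [erase_insert_of_ne (ne_of_mem_of_not_mem hi ha).symm,
          esymmOn_insert_succ (fun h => ha (mem_of_mem_erase h))]
        ring
      rw [sum_congr rfl h, sum_add_distrib, ← mul_sum, ih, ih]
      push_cast
      ring

theorem add_two_mul_esymmOn_div {s : Finset ι} {k : ℕ} (hk : k + 2 ≤ #s) {x : ι → ℝ}
    (hx : ∀ i, 0 < x i) :
    (k + 2) * (esymmOn s (k + 2) x / esymmOn s (k + 1) x) =
      ∑ i ∈ s, (x i - x i ^ 2 /
        (x i + esymmOn (s.erase i) (k + 1) x / esymmOn (s.erase i) k x)) := by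
  have hpos : 0 < esymmOn s (k + 1) x := esymmOn_pos (by omega) hx
  have h := sum_mul_esymmOn_erase s (k + 1) x
  rw [← mul_div_assoc, show ((k : ℝ) + 2) = ((k + 1 : ℕ) : ℝ) + 1 by push_cast; ring, ← h,
    sum_div]
  refine sum_congr rfl fun i hi => ?_
  have hcard := card_erase_of_mem hi
  have h₁ : 0 < esymmOn (s.erase i) k x := esymmOn_pos (by omega) hx
  have h₂ : 0 < esymmOn (s.erase i) (k + 1) x := esymmOn_pos (by omega) hx
  have hxi := hx i
  rw [esymmOn_succ_of_mem hi k]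
  have h₃ : 0 < x i * esymmOn (s.erase i) k x + esymmOn (s.erase i) (k + 1) x := by positivity
  field_simp
  ring

/-- The Marcus–Lopes inequality: quotients of consecutive elementary symmetric polynomials are
superadditive on the positive cone. -/
theorem esymmOn_div_add_le (k : ℕ) {s : Finset ι} (hk : k + 1 ≤ #s) {x y : ι → ℝ}
    (hx : ∀ i, 0 < x i) (hy : ∀ i, 0 < y i) :
    esymmOn s (k + 1) x / esymmOn s k x + esymmOn s (k + 1) y / esymmOn s k y ≤
      esymmOn s (k + 1) (x + y) / esymmOn s k (x + y) := by
  induction k generalizing s with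
  | zero => simp [esymmOn_one, sum_add_distrib]
  | succ k ih =>
    have hxy : ∀ i, 0 < (x + y) i := fun i => add_pos (hx i) (hy i)
    refine le_of_mul_le_mul_left ?_ (show (0 : ℝ) < k + 2 by positivity)
    rw [mul_add, add_two_mul_esymmOn_div hk hx, add_two_mul_esymmOn_div hk hy,
      add_two_mul_esymmOn_div hk hxy, ← sum_add_distrib]
    refine sum_le_sum fun i hi => ?_
    have hcard := card_erase_of_mem hi
    have hq : ∀ {z : ι → ℝ}, (∀ i, 0 < z i) →
        0 < esymmOn (s.erase i) (k + 1) z / esymmOn (s.erase i) k z := fun hz =>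
      div_pos (esymmOn_pos (by omega) hz) (esymmOn_pos (by omega) hz)
    have h := add_sq_div_add_le (hx i) (hy i) (hq hx) (hq hy) (ih (s := s.erase i) (by omega))
    simp only [Pi.add_apply]
    linarith

theorem esymmOn_rpow_add_le (k : ℕ) {s : Finset ι} (hk : k + 1 ≤ #s) {x y : ι → ℝ}
    (hx : ∀ i, 0 < x i) (hy : ∀ i, 0 < y i) :
    esymmOn s (k + 1) x ^ ((1 : ℝ) / (k + 1 : ℕ)) +
        esymmOn s (k + 1) y ^ ((1 : ℝ) / (k + 1 : ℕ)) ≤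
      esymmOn s (k + 1) (x + y) ^ ((1 : ℝ) / (k + 1 : ℕ)) := by
  induction k with
  | zero => simp [esymmOn_one, sum_add_distrib]
  | succ k ih =>
    have hxy : ∀ i, 0 < (x + y) i := fun i => add_pos (hx i) (hy i)
    have hr : ∀ {z : ι → ℝ}, (∀ i, 0 < z i) →
        0 < esymmOn s (k + 1) z ^ ((1 : ℝ) / (k + 1 : ℕ)) := fun hz =>
      Real.rpow_pos_of_pos (esymmOn_pos (by omega) hz) _
    have hq : ∀ {z : ι → ℝ}, (∀ i, 0 < z i) →
        0 < esymmOn s (k + 2) z / esymmOn s (k + 1) z := fun hz =>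
      div_pos (esymmOn_pos (by omega) hz) (esymmOn_pos (by omega) hz)
    rw [esymmOn_succ_rpow hk hx, esymmOn_succ_rpow hk hy, esymmOn_succ_rpow hk hxy]
    refine (rpow_mul_rpow_add_le (hr hx) (hr hy) (hq hx) (hq hy) (by positivity) (by positivity)
      (by field_simp; ring)).trans ?_
    have hrx := hr hx
    have hry := hr hy
    have hqx := hq hx
    have hqy := hq hy
    exact mul_le_mul
      (Real.rpow_le_rpow (by positivity) (ih (by omega)) (by positivity))
      (Real.rpow_le_rpow (by positivity) (esymmOn_div_add_le (k + 1) hk hx hy) (by positivity))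
      (by positivity) (Real.rpow_nonneg (hr hxy).le _)

end EsymmOn

theorem concaveOn_esymm_rpow_one_div (n k : ℕ) (hk : 1 ≤ k) (hkn : k ≤ n) :
    ConcaveOn ℝ {lam : Fin n → ℝ | ∀ i, 0 < lam i}
      (fun lam => esymmR n k lam ^ ((1 : ℝ) / k)) := by
  have hcard : k ≤ #(univ : Finset (Fin n)) := by simpa using hkn
  refine concaveOn_iff_forall_pos.2 ⟨?_, ?_⟩
  · intro x hx y hy a b ha hb hab i
    exact convex_Ioi (0 : ℝ) (hx i) (hy i) ha hb hab
  · intro x hx y hy a b ha hb _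
    change a * esymmOn univ k x ^ ((1 : ℝ) / k) + b * esymmOn univ k y ^ ((1 : ℝ) / k) ≤
      esymmOn univ k (a • x + b • y) ^ ((1 : ℝ) / k)
    rw [← esymmOn_rpow_smul (by omega) hcard ha.le hx,
      ← esymmOn_rpow_smul (by omega) hcard hb.le hy]
    obtain ⟨m, rfl⟩ := Nat.exists_eq_add_of_le' hk
    exact esymmOn_rpow_add_le m hcard (fun i => mul_pos ha (hx i)) (fun i => mul_pos hb (hy i))
end

section
/- For all integers 1 ≤ k ≤ n, the function σ_k^{1/k} is inverse concave on Γ₊; that is, the dual function λ ↦ ( σ_k(λ₁^{−1}, …, λ_n^{−1}) )^{−1/k} is concave on the open positive cone Γ₊ ⊂ ℝ^n. -/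
open Finset

/-- The product of the reciprocals is convex along segments in the positive cone. -/
lemma prod_inv_convex_combination_le {ι : Type*} (s : Finset ι) {x y : ι → ℝ}
    (hx : ∀ i, 0 < x i) (hy : ∀ i, 0 < y i) {a b : ℝ} (ha : 0 ≤ a) (hb : 0 ≤ b)
    (hab : a + b = 1) :
    ∏ i ∈ s, (a * x i + b * y i)⁻¹ ≤ a * ∏ i ∈ s, (x i)⁻¹ + b * ∏ i ∈ s, (y i)⁻¹ := by
  have hx' : ∀ i, 0 < (x i)⁻¹ := fun i => inv_pos.2 (hx i)
  have hy' : ∀ i, 0 < (y i)⁻¹ := fun i => inv_pos.2 (hy i)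
  calc ∏ i ∈ s, (a * x i + b * y i)⁻¹
      ≤ ∏ i ∈ s, ((x i)⁻¹ ^ a * (y i)⁻¹ ^ b) := by
        refine prod_le_prod (fun i _ => ?_) (fun i _ => ?_)
        · have := hx i
          have := hy i
          positivity
        · rw [Real.inv_rpow (hx i).le, Real.inv_rpow (hy i).le, ← mul_inv]
          exact inv_anti₀ (mul_pos (Real.rpow_pos_of_pos (hx i) a)
            (Real.rpow_pos_of_pos (hy i) b))
            (Real.geom_mean_le_arith_mean2_weighted ha hb (hx i).le (hy i).le hab)
    _ = (∏ i ∈ s, (x i)⁻¹) ^ a * (∏ i ∈ s, (y i)⁻¹) ^ b := by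
        rw [prod_mul_distrib, Real.finsetProd_rpow _ _ (fun i _ => (hx' i).le),
          Real.finsetProd_rpow _ _ (fun i _ => (hy' i).le)]
    _ ≤ _ := Real.geom_mean_le_arith_mean2_weighted ha hb
        (prod_nonneg fun i _ => (hx' i).le) (prod_nonneg fun i _ => (hy' i).le) hab

lemma convexOn_esymmR_inv (n k : ℕ) :
    ConvexOn ℝ {lam : Fin n → ℝ | ∀ i, 0 < lam i} (fun lam => esymmR n k fun i => (lam i)⁻¹) := by
  refine ⟨?_, fun x hx y hy a b ha hb hab => ?_⟩
  · intro x hx y hy a b ha hb hab i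
    exact convex_Ioi (0 : ℝ) (hx i) (hy i) ha hb hab
  · simp only [esymmR, smul_eq_mul, mul_sum, ← sum_add_distrib]
    exact sum_le_sum fun s _ => prod_inv_convex_combination_le s hx hy ha hb hab

lemma esymmR_pos {n k : ℕ} (hkn : k ≤ n) {lam : Fin n → ℝ} (h : ∀ i, 0 < lam i) :
    0 < esymmR n k lam :=
  sum_pos (fun _ _ => prod_pos fun i _ => h i) (powersetCard_nonempty.2 (by simpa using hkn))

lemma esymmR_smul (n k : ℕ) (c : ℝ) (lam : Fin n → ℝ) :
    esymmR n k (c • lam) = c ^ k * esymmR n k lam := by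
  rw [esymmR, esymmR, mul_sum]
  refine sum_congr rfl fun s hs => ?_
  simp [prod_mul_distrib, (mem_powersetCard.1 hs).2]

/-- A positive convex function on a convex cone that is homogeneous of degree `-k` becomes concave
when raised to the power `-1 / k`. -/
lemma ConvexOn.concaveOn_rpow_neg_one_div {E : Type*} [AddCommGroup E] [Module ℝ E] {C : Set E}
    {H : E → ℝ} {k : ℕ} (hk : k ≠ 0) (hH : ConvexOn ℝ C H) (hpos : ∀ x ∈ C, 0 < H x)
    (hC : ∀ c : ℝ, 0 < c → ∀ x ∈ C, c • x ∈ C)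
    (hhom : ∀ c : ℝ, 0 < c → ∀ x ∈ C, H (c • x) = c⁻¹ ^ k * H x) :
    ConcaveOn ℝ C (fun x => H x ^ (-(1 : ℝ) / k)) := by
  have hF : ∀ x ∈ C, 0 < H x ^ (-(1 : ℝ) / k) := fun x hx => Real.rpow_pos_of_pos (hpos x hx) _
  have hpow : ∀ x ∈ C, (H x ^ (-(1 : ℝ) / k)) ^ k = (H x)⁻¹ := fun x hx => by
    rw [← Real.rpow_mul_natCast (hpos x hx).le, div_mul_cancel₀ _ (Nat.cast_ne_zero.2 hk),
      Real.rpow_neg_one]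
  refine ⟨hH.1, fun x hx y hy a b ha hb hab => ?_⟩
  have hw := hH.1 hx hy ha hb hab
  have normalize : ∀ z ∈ C, H ((H z ^ (-(1 : ℝ) / k))⁻¹ • z) = 1 := fun z hz => by
    rw [hhom _ (inv_pos.2 (hF z hz)) z hz, inv_inv, hpow z hz, inv_mul_cancel₀ (hpos z hz).ne']
  have hx1 := normalize x hx
  have hy1 := normalize y hy
  have hpw := hpow _ hw
  have hFw := hF _ hw
  have hp := hF x hx
  have hq := hF y hy
  simp only [smul_eq_mul]
  generalize H x ^ (-(1 : ℝ) / k) = p at *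
  generalize H y ^ (-(1 : ℝ) / k) = q at *
  have hT : 0 < a * p + b * q := by
    rcases ha.eq_or_lt with rfl | ha'
    · obtain rfl : b = 1 := by linarith
      simpa using hq
    · have := mul_pos ha' hp
      have := mul_nonneg hb hq.le
      linarith
  set T := a * p + b * q
  have hcomb : (a * p / T) • p⁻¹ • x + (b * q / T) • q⁻¹ • y = T⁻¹ • (a • x + b • y) := by
    rw [smul_add]
    simp only [smul_smul]
    congr 2 <;> field_simp
  have hle : H (T⁻¹ • (a • x + b • y)) ≤ 1 := by
    have hsum : a * p / T + b * q / T = 1 := by rw [← add_div, div_self hT.ne']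
    have := hH.2 (hC _ (inv_pos.2 hp) x hx) (hC _ (inv_pos.2 hq) y hy)
      (by positivity : 0 ≤ a * p / T) (by positivity : 0 ≤ b * q / T) hsum
    rwa [hcomb, hx1, hy1, smul_eq_mul, smul_eq_mul, mul_one, mul_one, hsum] at this
  rw [hhom _ (inv_pos.2 hT) _ hw, inv_inv] at hle
  refine (pow_le_pow_iff_left₀ hT.le hFw.le hk).1 ?_
  rw [hpw]
  exact (le_inv_mul_iff₀' (hpos _ hw)).2 hle |>.trans_eq (mul_one _)

theorem concaveOn_dual_esymm_rpow_one_div (n k : ℕ) (hk : 1 ≤ k) (hkn : k ≤ n) :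
    ConcaveOn ℝ {lam : Fin n → ℝ | ∀ i, 0 < lam i}
      (fun lam => (esymmR n k (fun i => (lam i)⁻¹)) ^ (-(1 : ℝ) / k)) := by
  refine (convexOn_esymmR_inv n k).concaveOn_rpow_neg_one_div (by omega)
    (fun x hx => esymmR_pos hkn fun i => inv_pos.2 (hx i))
    (fun c hc x hx i => mul_pos hc (hx i)) (fun c _ x _ => ?_)
  rw [← esymmR_smul]
  congr 1
  ext i
  simp [mul_comm]
end

section
/- For all integers 1 ≤ k ≤ n and every λ in the open positive cone Γ₊ ⊂ ℝ^n, one has Σ_{i=1}^n λ_i² · (∂σ_k/∂λ_i)(λ) ≥ k · C(n,k)^{−1/k} · σ_k(λ)^{(k+1)/k}, where C(n,k) denotes the binomial coefficient n choose k. -/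
open Finset

theorem fderiv_esymmR_single (n k : ℕ) (lam : Fin n → ℝ) (i : Fin n) :
    fderiv ℝ (esymmR n k) lam (Pi.single i 1) =
      ∑ s ∈ powersetCard k (univ : Finset (Fin n)),
        if i ∈ s then ∏ j ∈ s.erase i, lam j else 0 := by
  have h : HasFDerivAt (esymmR n k)
      (∑ s ∈ powersetCard k (univ : Finset (Fin n)), ∑ i ∈ s, (∏ j ∈ s.erase i, lam j) •
        (ContinuousLinearMap.proj i : (Fin n → ℝ) →L[ℝ] ℝ)) lam :=
    HasFDerivAt.fun_sum fun s _ => hasFDerivAt_finsetProd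
  rw [h.fderiv]
  simp [Pi.single_apply]

theorem sum_sq_mul_fderiv_esymmR (n k : ℕ) (lam : Fin n → ℝ) :
    ∑ i, (lam i) ^ 2 * fderiv ℝ (esymmR n k) lam (Pi.single i 1) =
      ∑ s ∈ powersetCard k (univ : Finset (Fin n)), (∏ i ∈ s, lam i) * ∑ i ∈ s, lam i := by
  simp_rw [fderiv_esymmR_single, mul_sum]
  rw [sum_comm]
  refine sum_congr rfl fun s _ => ?_
  simp_rw [mul_ite, mul_zero]
  rw [sum_ite_mem, univ_inter]
  refine sum_congr rfl fun i hi => ?_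
  rw [← mul_prod_erase s lam hi]
  ring

/-- The inequality of arithmetic and geometric means, multiplied through by the product. -/
theorem card_mul_prod_rpow_le_prod_mul_sum {ι : Type*} {s : Finset ι} (hs : s.Nonempty)
    {z : ι → ℝ} (hz : ∀ i ∈ s, 0 < z i) :
    (#s : ℝ) * (∏ i ∈ s, z i) ^ (((#s : ℝ) + 1) / #s) ≤ (∏ i ∈ s, z i) * ∑ i ∈ s, z i := by
  have hc : (0 : ℝ) < #s := by exact_mod_cast hs.card_pos
  have hP : 0 < ∏ i ∈ s, z i := prod_pos hz
  have h := Real.geom_mean_le_arith_mean s (fun _ => 1) z (fun _ _ => zero_le_one)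
    (by simpa using hs) (fun i hi => (hz i hi).le)
  simp only [Real.rpow_one, sum_const, nsmul_eq_mul, mul_one, one_mul] at h
  rw [le_div_iff₀ hc] at h
  have he : ((#s : ℝ) + 1) / #s = 1 + (#s : ℝ)⁻¹ := by field_simp
  rw [he, Real.rpow_add hP, Real.rpow_one]
  nlinarith

theorem esymm_deriv_sq_lower_bound (n k : ℕ) (hk : 1 ≤ k) (hkn : k ≤ n)
    (lam : Fin n → ℝ) (hlam : ∀ i, 0 < lam i) :
    ∑ i, (lam i) ^ 2 * fderiv ℝ (esymmR n k) lam (Pi.single i 1)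
      ≥ (k : ℝ) * ((n.choose k : ℝ)) ^ (-(1 : ℝ) / k)
          * esymmR n k lam ^ (((k : ℝ) + 1) / k) := by
  have hk0 : (0 : ℝ) < k := by exact_mod_cast hk
  have hN : (0 : ℝ) < n.choose k := by exact_mod_cast Nat.choose_pos hkn
  have hp : ((k : ℝ) + 1) / k - 1 = 1 / k := by field_simp; ring
  have hp1 : 1 ≤ ((k : ℝ) + 1) / k := by
    have : (0 : ℝ) < 1 / k := by positivity
    linarith
  have hpow := Real.rpow_sum_le_const_mul_sum_rpow_of_nonneg
    (powersetCard k (univ : Finset (Fin n))) (f := fun s => ∏ i ∈ s, lam i) hp1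
    (fun s _ => prod_nonneg fun i _ => (hlam i).le)
  rw [card_powersetCard, card_univ, Fintype.card_fin, hp] at hpow
  have hmean : (n.choose k : ℝ) ^ (-(1 : ℝ) / k) * esymmR n k lam ^ (((k : ℝ) + 1) / k) ≤
      ∑ s ∈ powersetCard k (univ : Finset (Fin n)), (∏ i ∈ s, lam i) ^ (((k : ℝ) + 1) / k) := by
    rw [neg_div, Real.rpow_neg hN.le, inv_mul_le_iff₀ (by positivity)]
    exact hpow
  rw [ge_iff_le, sum_sq_mul_fderiv_esymmR, mul_assoc]
  refine (mul_le_mul_of_nonneg_left hmean hk0.le).trans ?_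
  rw [mul_sum]
  refine sum_le_sum fun s hs => ?_
  obtain rfl := (mem_powersetCard.mp hs).2
  exact card_mul_prod_rpow_le_prod_mul_sum (card_pos.mp hk) fun i _ => hlam i
end

section
/- Let n ≥ 2 and 1 ≤ k ≤ n be integers and let λ₁, λ₂ ∈ ℝ. At the point p = (λ₁, λ₂, λ₂, …, λ₂) ∈ ℝ^n (the first coordinate equals λ₁ and the remaining n−1 coordinates equal λ₂), the partial derivatives of σ_k satisfy (∂σ_k/∂λ₁)(p) · (kλ₁ + (n−k)λ₂) = k·σ_k(p) and (∂σ_k/∂λ₂)(p) · (n−1)·λ₂·(kλ₁ + (n−k)λ₂) = k·(λ₁(k−1) + λ₂(n−k))·σ_k(p). -/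
open Finset

/-- Splitting the elementary symmetric sum over `insert a s` by membership of `a`. -/
lemma sum_powersetCard_succ_insert_prod {ι R : Type*} [DecidableEq ι] [CommSemiring R]
    {a : ι} {s : Finset ι} (ha : a ∉ s) (m : ℕ) (f : ι → R) :
    ∑ t ∈ powersetCard (m + 1) (insert a s), ∏ i ∈ t, f i
      = ∑ t ∈ powersetCard (m + 1) s, ∏ i ∈ t, f i
        + f a * ∑ t ∈ powersetCard m s, ∏ i ∈ t, f i := by
  have notMem {j : ℕ} {t : Finset ι} (ht : t ∈ powersetCard j s) : a ∉ t :=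
    fun h => ha ((mem_powersetCard.1 ht).1 h)
  rw [powersetCard_succ_insert ha, sum_union, sum_image, mul_sum]
  · congr 1
    exact sum_congr rfl fun t ht => prod_insert (notMem ht)
  · intro t ht u hu h
    rw [← erase_insert (notMem ht), ← erase_insert (notMem hu), h]
  · refine disjoint_left.2 fun t ht ht' => ?_
    obtain ⟨u, -, rfl⟩ := mem_image.1 ht'
    exact notMem ht (mem_insert_self a u)

lemma sum_powersetCard_prod_of_eq_const {ι R : Type*} [CommSemiring R] {s : Finset ι}
    {f : ι → R} {c : R} (hf : ∀ i ∈ s, f i = c) (m : ℕ) :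
    ∑ t ∈ powersetCard m s, ∏ i ∈ t, f i = (s.card.choose m : R) * c ^ m := by
  have h : ∀ t ∈ powersetCard m s, ∏ i ∈ t, f i = c ^ m := fun t ht => by
    obtain ⟨hts, rfl⟩ := mem_powersetCard.1 ht
    exact prod_eq_pow_card fun i hi => hf i (hts hi)
  rw [sum_congr rfl h, sum_const, card_powersetCard, nsmul_eq_mul]

lemma esymmR_succ_eq (n m : ℕ) (i : Fin n) (x : Fin n → ℝ) :
    esymmR n (m + 1) x
      = ∑ t ∈ powersetCard (m + 1) (univ.erase i), ∏ j ∈ t, x j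
        + x i * ∑ t ∈ powersetCard m (univ.erase i), ∏ j ∈ t, x j := by
  rw [← sum_powersetCard_succ_insert_prod (notMem_erase i univ), insert_erase (mem_univ i)]
  rfl

/-- The `i`-th partial derivative of `σ_{m+1}` is `σ_m` in the remaining variables. -/
lemma fderiv_esymmR_succ_single (n m : ℕ) (i : Fin n) (x : Fin n → ℝ) :
    fderiv ℝ (esymmR n (m + 1)) x (Pi.single i 1)
      = ∑ t ∈ powersetCard m (univ.erase i), ∏ j ∈ t, x j := by
  have hd : DifferentiableAt ℝ (esymmR n (m + 1)) x := by
    unfold esymmR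
    fun_prop
  have hline := hd.hasFDerivAt.hasLineDerivAt (Pi.single i 1)
  refine HasDerivAt.unique hline ?_
  have hconst (j : ℕ) (r : ℝ) :
      ∑ t ∈ powersetCard j (univ.erase i), ∏ l ∈ t, (x + r • (Pi.single i 1 : Fin n → ℝ)) l
        = ∑ t ∈ powersetCard j (univ.erase i), ∏ l ∈ t, x l := by
    refine sum_congr rfl fun t ht => prod_congr rfl fun l hl => ?_
    have hli : l ≠ i := ne_of_mem_erase ((mem_powersetCard.1 ht).1 hl)
    simp [hli]
  simp only [esymmR_succ_eq n m i, hconst]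
  simpa using (((hasDerivAt_id (0 : ℝ)).const_add (x i)).mul_const
    (∑ t ∈ powersetCard m (univ.erase i), ∏ l ∈ t, x l)).const_add
      (∑ t ∈ powersetCard (m + 1) (univ.erase i), ∏ l ∈ t, x l)

theorem esymm_partials_at_axially_symmetric_point (n k : ℕ) (hn : 2 ≤ n)
    (hk : 1 ≤ k) (hkn : k ≤ n) (l1 l2 : ℝ) :
    fderiv ℝ (esymmR n k) (fun i => if (i : ℕ) = 0 then l1 else l2)
        (Pi.single (⟨0, by omega⟩ : Fin n) 1) * ((k : ℝ) * l1 + ((n : ℝ) - k) * l2)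
      = (k : ℝ) * esymmR n k (fun i => if (i : ℕ) = 0 then l1 else l2) ∧
    fderiv ℝ (esymmR n k) (fun i => if (i : ℕ) = 0 then l1 else l2)
        (Pi.single (⟨1, by omega⟩ : Fin n) 1)
        * (((n : ℝ) - 1) * l2 * ((k : ℝ) * l1 + ((n : ℝ) - k) * l2))
      = (k : ℝ) * (l1 * ((k : ℝ) - 1) + l2 * ((n : ℝ) - k))
          * esymmR n k (fun i => if (i : ℕ) = 0 then l1 else l2) := by
  obtain ⟨m, rfl⟩ : ∃ m, k = m + 1 := ⟨k - 1, by omega⟩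
  obtain ⟨N, rfl⟩ : ∃ N, n = N + 2 := ⟨n - 2, by omega⟩
  set p : Fin (N + 2) → ℝ := fun i => if (i : ℕ) = 0 then l1 else l2 with hp
  set a : Fin (N + 2) := ⟨0, by omega⟩ with ha
  set b : Fin (N + 2) := ⟨1, by omega⟩ with hb
  have hab : a ≠ b := by simp [ha, hb]
  have hpa : p a = l1 := by simp [hp, ha]
  have hpne (i : Fin (N + 2)) (hi : i ≠ a) : p i = l2 := by
    exact if_neg fun h => hi (Fin.ext h)
  have hsum (j : ℕ) : ∑ t ∈ powersetCard j (univ.erase a), ∏ i ∈ t, p i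
      = ((N + 1).choose j : ℝ) * l2 ^ j := by
    rw [sum_powersetCard_prod_of_eq_const (fun i hi => hpne i (ne_of_mem_erase hi))]
    simp
  have hsum' (j : ℕ) : ∑ t ∈ powersetCard j ((univ.erase b).erase a), ∏ i ∈ t, p i
      = (N.choose j : ℝ) * l2 ^ j := by
    rw [sum_powersetCard_prod_of_eq_const (fun i hi => hpne i (ne_of_mem_erase hi)),
      card_erase_of_mem (mem_erase.2 ⟨hab, mem_univ a⟩)]
    simp
  have hσ : ((m + 1 : ℕ) : ℝ) * esymmR (N + 2) (m + 1) p
      = ((N + 1).choose m : ℝ) * l2 ^ m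
        * (((m + 1 : ℕ) : ℝ) * l1 + (((N + 2 : ℕ) : ℝ) - ((m + 1 : ℕ) : ℝ)) * l2) := by
    have hc : ((N + 1).choose (m + 1) : ℝ) * (m + 1) = (N + 1).choose m * (N + 1 - m) := by
      have h := Nat.choose_succ_right_eq (N + 1) m
      rw [← @Nat.cast_inj ℝ] at h
      push_cast [Nat.cast_sub (show m ≤ N + 1 by omega)] at h
      exact h
    rw [esymmR_succ_eq _ _ a, hsum, hsum, hpa]
    push_cast
    linear_combination l2 ^ (m + 1) * hc
  have hpartial : fderiv ℝ (esymmR (N + 2) (m + 1)) p (Pi.single b 1) * ((N + 1) * l2)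
      = ((N + 1).choose m : ℝ) * l2 ^ m * (l1 * m + l2 * (N + 1 - m)) := by
    rw [fderiv_esymmR_succ_single]
    rcases m with _ | j
    · simp
      ring
    · have hc : ((N : ℝ) + 1) * N.choose j = (N + 1).choose (j + 1) * (j + 1) := by
        exact_mod_cast Nat.add_one_mul_choose_eq N j
      have hpascal : ((N + 1).choose (j + 1) : ℝ) = N.choose j + N.choose (j + 1) := by
        exact_mod_cast Nat.choose_succ_succ N j
      rw [← insert_erase (mem_erase.2 ⟨hab, mem_univ a⟩),
        sum_powersetCard_succ_insert_prod (notMem_erase a _), hsum', hsum', hpa]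
      push_cast
      linear_combination l2 ^ (j + 1) * (l1 - l2) * hc - l2 ^ (j + 2) * (N + 1) * hpascal
  refine ⟨?_, ?_⟩
  · rw [fderiv_esymmR_succ_single, hsum, hσ]
  · push_cast at hσ ⊢
    linear_combination ((m + 1) * l1 + (N + 1 - m) * l2) * hpartial
      - (l1 * m + l2 * (N + 1 - m)) * hσ
end

section
/- Let n ≥ 2 and 1 ≤ k ≤ n be integers, let α ∈ ℝ, and let λ₁, λ₂ > 0. Define F : Γ₊ → ℝ by F(μ) = σ_k(μ)^α and G : Γ₊ → ℝ by G(μ) = F(μ)² · Σ_{1≤i<j≤n} (1/μ_i − 1/μ_j)². Then at the point p = (λ₁, λ₂, λ₂, …, λ₂) ∈ Γ₊ one has (1 + kα)·F(p)·( Σ_{i=1}^n ∂G/∂μ_i(p) ) − 2(kα − 1)·G(p)·( Σ_{i=1}^n ∂F/∂μ_i(p) ) = (2·F(p)·G(p) / (λ₁λ₂(kλ₁ + (n−k)λ₂))) · ( k((k−2)α − 1)λ₁² − (kα(2k−n−2) + n)λ₁λ₂ − (n−k)(1+kα)λ₂² ). -/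
open Finset

/-- The speed function `F = σ_k^α`. -/
noncomputable def Fpow (n k : ℕ) (α : ℝ) (lam : Fin n → ℝ) : ℝ :=
  esymmR n k lam ^ α

/-- The pinching quantity `G = F² · Σ_{i<j} (1/λ_i − 1/λ_j)²`. -/
noncomputable def Gpow (n k : ℕ) (α : ℝ) (lam : Fin n → ℝ) : ℝ :=
  Fpow n k α lam ^ 2 *
    ∑ p ∈ (univ : Finset (Fin n × Fin n)).filter (fun p => p.1 < p.2),
      (1 / lam p.1 - 1 / lam p.2) ^ 2

/-- The point `(a, b, …, b)`. -/
def axialPoint (n : ℕ) (a b : ℝ) : Fin n → ℝ := fun i => if (i : ℕ) = 0 then a else b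

/-- The elementary symmetric polynomial of positive degree at `(a, b, …, b)`. -/
lemma esymmR_axialPoint (m j : ℕ) (a b : ℝ) :
    esymmR (m + 1) (j + 1) (axialPoint (m + 1) a b)
      = (m.choose (j + 1) : ℝ) * b ^ (j + 1) + (m.choose j : ℝ) * (a * b ^ j) := by
  have hprod : ∀ s ⊆ (univ : Finset (Fin (m + 1))).erase 0,
      ∏ i ∈ s, axialPoint (m + 1) a b i = b ^ s.card := by
    intro s hs
    refine prod_eq_pow_card fun i hi => ?_
    have hi0 : i ≠ 0 := (mem_erase.mp (hs hi)).1
    have : (i : ℕ) ≠ 0 := fun h => hi0 (Fin.ext h)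
    simp [axialPoint, this]
  have hnot : ∀ s ⊆ (univ : Finset (Fin (m + 1))).erase 0, (0 : Fin (m + 1)) ∉ s :=
    fun s hs h => (mem_erase.mp (hs h)).1 rfl
  have hcard : ((univ : Finset (Fin (m + 1))).erase 0).card = m := by simp
  unfold esymmR
  rw [← insert_erase (mem_univ (0 : Fin (m + 1))),
    powersetCard_succ_insert (notMem_erase _ _), sum_union, sum_image]
  · congr 1
    · rw [sum_congr rfl (g := fun _ => b ^ (j + 1)), sum_const, card_powersetCard, hcard,
        nsmul_eq_mul]
      intro s hs
      rw [mem_powersetCard] at hs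
      rw [hprod s hs.1, hs.2]
    · rw [sum_congr rfl (g := fun _ => a * b ^ j), sum_const, card_powersetCard, hcard,
        nsmul_eq_mul]
      intro s hs
      rw [mem_powersetCard] at hs
      rw [prod_insert (hnot s hs.1), hprod s hs.1, hs.2]
      simp [axialPoint]
  · intro s hs t ht hst
    simp only [mem_coe, mem_powersetCard] at hs ht
    rw [← erase_insert (hnot s hs.1), ← erase_insert (hnot t ht.1)]
    exact congrArg (fun u => u.erase 0) hst
  · rw [disjoint_left]
    intro s hs hs'
    obtain ⟨t, -, rfl⟩ := mem_image.mp hs'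
    exact hnot _ (mem_powersetCard.mp hs).1 (mem_insert_self _ _)

/-- The sum of squared differences of reciprocals at `(a, b, …, b)`. -/
lemma sum_reciprocal_sub_sq_axialPoint (m : ℕ) (a b : ℝ) :
    ∑ p ∈ (univ : Finset (Fin (m + 1) × Fin (m + 1))).filter (fun p => p.1 < p.2),
      (1 / axialPoint (m + 1) a b p.1 - 1 / axialPoint (m + 1) a b p.2) ^ 2
      = m * (1 / a - 1 / b) ^ 2 := by
  rw [sum_filter, Fintype.sum_prod_type]
  simp [Fin.sum_univ_succ, axialPoint]

lemma axialPoint_ne_zero {a b : ℝ} (ha : a ≠ 0) (hb : b ≠ 0) (n : ℕ) (i : Fin n) :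
    axialPoint n a b i ≠ 0 := by
  unfold axialPoint
  split_ifs <;> assumption

lemma axialPoint_add_smul_one (n : ℕ) (a b t : ℝ) :
    axialPoint n a b + t • (1 : Fin n → ℝ) = axialPoint n (a + t) (b + t) := by
  ext i
  simp only [axialPoint, Pi.add_apply, Pi.smul_apply, Pi.one_apply, smul_eq_mul, mul_one]
  split_ifs <;> rfl

lemma differentiable_esymmR (n k : ℕ) : Differentiable ℝ (esymmR n k) := by
  unfold esymmR
  fun_prop

lemma differentiableAt_Fpow {n k : ℕ} {α : ℝ} {x : Fin n → ℝ} (hx : esymmR n k x ≠ 0) :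
    DifferentiableAt ℝ (Fpow n k α) x :=
  (differentiable_esymmR n k x).rpow_const (Or.inl hx)

lemma differentiableAt_Gpow {n k : ℕ} {α : ℝ} {x : Fin n → ℝ} (hσ : esymmR n k x ≠ 0)
    (hx : ∀ i, x i ≠ 0) : DifferentiableAt ℝ (Gpow n k α) x := by
  unfold Gpow
  refine ((differentiableAt_Fpow hσ).pow 2).mul ?_
  refine DifferentiableAt.fun_sum fun p _ => ?_
  have hinv : ∀ i, DifferentiableAt ℝ (fun y : Fin n → ℝ => 1 / y i) x := fun i => by
    simp only [one_div]
    exact (differentiableAt_apply i x).inv (hx i)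
  exact ((hinv p.1).sub (hinv p.2)).pow 2

/-- The sum of the partial derivatives is the derivative in the direction `(1, …, 1)`. -/
lemma sum_fderiv_single_eq {n : ℕ} {f : (Fin n → ℝ) → ℝ} {x : Fin n → ℝ} {d : ℝ}
    (hf : DifferentiableAt ℝ f x) (hd : HasDerivAt (fun t : ℝ => f (x + t • 1)) d 0) :
    ∑ i, fderiv ℝ f x (Pi.single i 1) = d := by
  have hsum : ∑ i : Fin n, Pi.single i (1 : ℝ) = (1 : Fin n → ℝ) :=
    univ_sum_single (1 : Fin n → ℝ)
  rw [← map_sum, hsum, ← hf.lineDeriv_eq_fderiv]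
  exact hd.deriv

theorem zero_order_terms_at_axially_symmetric_point (n k : ℕ) (hn : 2 ≤ n)
    (hk : 1 ≤ k) (hkn : k ≤ n) (α : ℝ) (l1 l2 : ℝ) (h1 : 0 < l1) (h2 : 0 < l2) :
    (1 + (k : ℝ) * α) * Fpow n k α (fun i => if (i : ℕ) = 0 then l1 else l2) *
          (∑ i, fderiv ℝ (Gpow n k α) (fun i => if (i : ℕ) = 0 then l1 else l2)
            (Pi.single i 1))
        - 2 * ((k : ℝ) * α - 1) * Gpow n k α (fun i => if (i : ℕ) = 0 then l1 else l2) *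
          (∑ i, fderiv ℝ (Fpow n k α) (fun i => if (i : ℕ) = 0 then l1 else l2)
            (Pi.single i 1))
      = 2 * Fpow n k α (fun i => if (i : ℕ) = 0 then l1 else l2)
          * Gpow n k α (fun i => if (i : ℕ) = 0 then l1 else l2)
          / (l1 * l2 * ((k : ℝ) * l1 + ((n : ℝ) - k) * l2))
        * ((k : ℝ) * (((k : ℝ) - 2) * α - 1) * l1 ^ 2
            - ((k : ℝ) * α * (2 * (k : ℝ) - n - 2) + n) * l1 * l2
            - ((n : ℝ) - k) * (1 + (k : ℝ) * α) * l2 ^ 2) := by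
  obtain ⟨m, rfl⟩ : ∃ m, n = m + 1 := ⟨n - 1, by omega⟩
  obtain ⟨j, rfl⟩ : ∃ j, k = j + 1 := ⟨k - 1, by omega⟩
  have hjm : j ≤ m := by omega
  change (1 + ((j + 1 : ℕ) : ℝ) * α) * Fpow (m + 1) (j + 1) α (axialPoint (m + 1) l1 l2) *
          (∑ i, fderiv ℝ (Gpow (m + 1) (j + 1) α) (axialPoint (m + 1) l1 l2) (Pi.single i 1))
        - 2 * (((j + 1 : ℕ) : ℝ) * α - 1) *
            Gpow (m + 1) (j + 1) α (axialPoint (m + 1) l1 l2) *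
          (∑ i, fderiv ℝ (Fpow (m + 1) (j + 1) α) (axialPoint (m + 1) l1 l2) (Pi.single i 1))
      = 2 * Fpow (m + 1) (j + 1) α (axialPoint (m + 1) l1 l2)
          * Gpow (m + 1) (j + 1) α (axialPoint (m + 1) l1 l2) / _ * _
  set x := axialPoint (m + 1) l1 l2 with hx
  set F := Fpow (m + 1) (j + 1) α x with hF
  set G := Gpow (m + 1) (j + 1) α x with hG
  have hC : (0 : ℝ) < m.choose j := by exact_mod_cast Nat.choose_pos hjm
  have hchoose : (m.choose (j + 1) : ℝ) = (m - j) / (j + 1) * m.choose j := by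
    have h := Nat.choose_succ_right_eq m j
    have h' : (m.choose (j + 1) : ℝ) * (j + 1) = m.choose j * (m - j) := by
      rw [← Nat.cast_sub hjm]
      exact_mod_cast h
    field_simp
    linarith
  have hmj : (0 : ℝ) ≤ m - j := sub_nonneg.mpr (by exact_mod_cast hjm)
  have hD : 0 < (j + 1 : ℝ) * l1 + (m - j) * l2 := by positivity
  have hσ : esymmR (m + 1) (j + 1) x
      = m.choose j * l2 ^ j / (j + 1) * ((j + 1) * l1 + (m - j) * l2) := by
    rw [hx, esymmR_axialPoint, hchoose]
    field_simp
    ring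
  have hσpos : 0 < esymmR (m + 1) (j + 1) x := by rw [hσ]; positivity
  set r : ℝ := (j + 1) * ((m - j + 1) * l2 + j * l1) / (l2 * ((j + 1) * l1 + (m - j) * l2))
    with hr
  have hσ' : HasDerivAt (fun t : ℝ => esymmR (m + 1) (j + 1) (x + t • 1))
      (esymmR (m + 1) (j + 1) x * r) 0 := by
    simp only [hx, axialPoint_add_smul_one, esymmR_axialPoint]
    rw [← esymmR_axialPoint, ← hx, hσ]
    have ha : HasDerivAt (fun t : ℝ => l1 + t) 1 0 := (hasDerivAt_id _).const_add _
    have hb : HasDerivAt (fun t : ℝ => l2 + t) 1 0 := (hasDerivAt_id _).const_add _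
    refine (((hb.fun_pow (j + 1)).const_mul (m.choose (j + 1) : ℝ)).fun_add
      ((ha.fun_mul (hb.fun_pow j)).const_mul (m.choose j : ℝ))).congr_deriv ?_
    rw [hchoose, hr]
    rcases j with _ | j
    · simp
      field_simp
    · push_cast at hD ⊢
      have hD0 := hD.ne'
      simp only [add_zero]
      field_simp
      ring
  have hF' : HasDerivAt (fun t : ℝ => Fpow (m + 1) (j + 1) α (x + t • 1)) (F * (α * r)) 0 := by
    have hσ0 : esymmR (m + 1) (j + 1) (x + (0 : ℝ) • 1) = esymmR (m + 1) (j + 1) x := by simp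
    refine (hσ'.rpow_const (p := α) (Or.inl (by rw [hσ0]; exact hσpos.ne'))).congr_deriv ?_
    rw [hσ0, Real.rpow_sub_one hσpos.ne', hF, Fpow]
    field_simp
  have hGeq : G = F ^ 2 * (m * (1 / l1 - 1 / l2) ^ 2) := by
    rw [hG, Gpow, hx, sum_reciprocal_sub_sq_axialPoint]
  have hG' : HasDerivAt (fun t : ℝ => Gpow (m + 1) (j + 1) α (x + t • 1))
      (2 * G * (α * r - (l1 + l2) / (l1 * l2))) 0 := by
    have hsum : ∀ t : ℝ, Gpow (m + 1) (j + 1) α (x + t • 1)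
        = Fpow (m + 1) (j + 1) α (x + t • 1) ^ 2
          * (m * ((l1 + t)⁻¹ - (l2 + t)⁻¹) ^ 2) := fun t => by
      rw [Gpow, hx, axialPoint_add_smul_one, sum_reciprocal_sub_sq_axialPoint, one_div, one_div]
    simp only [hsum]
    have ha : HasDerivAt (fun t : ℝ => (l1 + t)⁻¹) (-1 / (l1 + 0) ^ 2) 0 :=
      ((hasDerivAt_id (0 : ℝ)).const_add l1).fun_inv (by simpa using h1.ne')
    have hb : HasDerivAt (fun t : ℝ => (l2 + t)⁻¹) (-1 / (l2 + 0) ^ 2) 0 :=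
      ((hasDerivAt_id (0 : ℝ)).const_add l2).fun_inv (by simpa using h2.ne')
    refine ((hF'.fun_pow 2).fun_mul
      (((ha.fun_sub hb).fun_pow 2).const_mul (m : ℝ))).congr_deriv ?_
    rw [hGeq]
    simp only [zero_smul, add_zero, ← hF, Nat.add_one_sub_one, pow_one, Nat.cast_ofNat]
    field_simp
    ring
  rw [sum_fderiv_single_eq (differentiableAt_Fpow hσpos.ne') hF',
    sum_fderiv_single_eq
      (differentiableAt_Gpow hσpos.ne' (axialPoint_ne_zero h1.ne' h2.ne' _)) hG', hr]
  have hD' : (j + 1 : ℝ) * l1 + ((m + 1) - (j + 1)) * l2 ≠ 0 := by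
    rw [add_sub_add_right_eq_sub]
    exact hD.ne'
  push_cast
  rw [add_sub_add_right_eq_sub] at hD' ⊢
  field_simp
  ring
end

section
/- Let n ≥ 3 and 1 ≤ k ≤ n be integers and define c₂(n,k) as follows: c₂(n,k) = (4√(n(n−k)(n+2−2k)) − 2k(n+2) + n(6+n)) / (k(n−2)²) if either k ∈ {1,2}, or k ≥ 3 and n > k(k−1); and c₂(n,k) = 1/(k−2) otherwise. If α ∈ ℝ satisfies 1/k ≤ α ≤ c₂(n,k), then for all λ₁ > 0 and λ₂ > 0, k((k−2)α − 1)λ₁² − (kα(2k−n−2) + n)λ₁λ₂ − (n−k)(1+kα)λ₂² ≤ 0. -/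
/-- The constant `c₂(n,k)` from the paper. -/
noncomputable def c2 (n k : ℕ) : ℝ :=
  if (k = 1 ∨ k = 2) ∨ (3 ≤ k ∧ k * (k - 1) < n) then
    (4 * Real.sqrt ((n : ℝ) * ((n : ℝ) - k) * ((n : ℝ) + 2 - 2 * k))
        - 2 * k * ((n : ℝ) + 2) + (n : ℝ) * (6 + n)) / (k * ((n : ℝ) - 2) ^ 2)
  else 1 / ((k : ℝ) - 2)

/-- A binary quadratic form `A x² - B x y - C y²` with `0 < C` and nonpositive discriminant
is nonpositive. -/
theorem quadratic_form_nonpos_of_discrim_nonpos {A B C : ℝ} (hC : 0 < C)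
    (hD : B ^ 2 + 4 * A * C ≤ 0) (x y : ℝ) : A * x ^ 2 - B * x * y - C * y ^ 2 ≤ 0 := by
  have h : 4 * C * (A * x ^ 2 - B * x * y - C * y ^ 2) ≤ 0 := by
    nlinarith [mul_nonneg (neg_nonneg.2 hD) (sq_nonneg x), sq_nonneg (2 * C * y + B * x)]
  exact nonpos_of_mul_nonpos_right h (by positivity)

/-- The discriminant, as a function of `a = k α`, is nonpositive between `1` and its larger
root. -/
theorem discrim_nonpos_of_le_root {n k a : ℝ} (hn : 2 < n) (hkn : k ≤ n) (h2k : 2 * k ≤ n + 2)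
    (hk : (k + 1) ^ 2 ≤ 4 * n) (ha1 : 1 ≤ a)
    (ha : a * (n - 2) ^ 2 ≤
      4 * Real.sqrt (n * (n - k) * (n + 2 - 2 * k)) - 2 * k * (n + 2) + n * (6 + n)) :
    (a * (2 * k - n - 2) + n) ^ 2 + 4 * ((k - 2) * a - k) * ((n - k) * (1 + a)) ≤ 0 := by
  have hnn : 0 ≤ n * (n - k) * (n + 2 - 2 * k) :=
    mul_nonneg (mul_nonneg (by linarith) (sub_nonneg.2 hkn)) (by linarith)
  have hs := Real.sq_sqrt hnn
  have hs0 := Real.sqrt_nonneg (n * (n - k) * (n + 2 - 2 * k))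
  set s := Real.sqrt (n * (n - k) * (n + 2 - 2 * k))
  have hD : 0 < (n - 2) ^ 2 := pow_pos (by linarith) 2
  set N := n * (6 + n) - 2 * k * (n + 2) with hN
  have hone : ((n - 2) ^ 2 - N) ^ 2 ≤ (4 * s) ^ 2 := by
    have h := mul_nonneg hD.le (sub_nonneg.2 hk)
    rw [mul_pow, hs, hN]
    linarith
  have hlow := (abs_le_of_sq_le_sq' hone (by linarith)).1
  have hmul : (n - 2) ^ 2 ≤ a * (n - 2) ^ 2 := le_mul_of_one_le_left hD.le ha1
  have hsq : (a * (n - 2) ^ 2 - N) ^ 2 ≤ (4 * s) ^ 2 :=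
    sq_le_sq' (by linarith) (by linarith)
  rw [mul_pow, hs, hN] at hsq
  refine nonpos_of_mul_nonpos_right (a := (n - 2) ^ 2) ?_ hD
  linarith

theorem quadratic_nonpos_of_alpha_le_c2 (n k : ℕ) (hn : 3 ≤ n) (hk : 1 ≤ k)
    (hkn : k ≤ n) (α : ℝ) (hα1 : 1 / (k : ℝ) ≤ α) (hα2 : α ≤ c2 n k)
    (l1 l2 : ℝ) (h1 : 0 < l1) (h2 : 0 < l2) :
    (k : ℝ) * (((k : ℝ) - 2) * α - 1) * l1 ^ 2
        - ((k : ℝ) * α * (2 * (k : ℝ) - n - 2) + n) * l1 * l2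
        - ((n : ℝ) - k) * (1 + (k : ℝ) * α) * l2 ^ 2 ≤ 0 := by
  have hk0 : (0 : ℝ) < k := by exact_mod_cast hk
  have hn3 : (3 : ℝ) ≤ n := by exact_mod_cast hn
  have hknR : (k : ℝ) ≤ n := by exact_mod_cast hkn
  have ha1 : 1 ≤ (k : ℝ) * α := by
    rwa [div_le_iff₀' hk0] at hα1
  unfold c2 at hα2
  split_ifs at hα2 with hcase
  · have hbounds : (k : ℝ) < n ∧ 2 * (k : ℝ) ≤ n + 2 ∧ ((k : ℝ) + 1) ^ 2 ≤ 4 * n := by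
      rcases hcase with (rfl | rfl) | ⟨hk3, hlt⟩
      · norm_num
        constructor <;> linarith
      · norm_num
        refine ⟨?_, ?_, ?_⟩ <;> linarith
      · have hk3R : (3 : ℝ) ≤ k := by exact_mod_cast hk3
        have hltR : (k : ℝ) * (k - 1) < n := by
          have h : ((k * (k - 1) : ℕ) : ℝ) < n := by exact_mod_cast hlt
          rwa [Nat.cast_mul, Nat.cast_sub hk, Nat.cast_one] at h
        refine ⟨?_, ?_, ?_⟩ <;> nlinarith
    obtain ⟨hlt, h2k, hsq⟩ := hbounds
    have hroot := (le_div_iff₀ (mul_pos hk0 (pow_pos (by linarith : (0 : ℝ) < n - 2) 2))).1 hα2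
    have hdisc := discrim_nonpos_of_le_root (a := k * α) (by linarith) hknR h2k hsq ha1
      (by linarith)
    have hC : 0 < ((n : ℝ) - k) * (1 + k * α) := mul_pos (by linarith) (by linarith)
    have h := quadratic_form_nonpos_of_discrim_nonpos hC hdisc l1 l2
    linarith
  · have hk3 : 3 ≤ k := by omega
    have hk3R : (3 : ℝ) ≤ k := by exact_mod_cast hk3
    have hle : (n : ℝ) ≤ k * (k - 1) := by
      have h : n ≤ k * (k - 1) := by
        by_contra! h
        exact hcase (Or.inr ⟨hk3, h⟩)
      have h' : (n : ℝ) ≤ ((k * (k - 1) : ℕ) : ℝ) := by exact_mod_cast h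
      rwa [Nat.cast_mul, Nat.cast_sub hk, Nat.cast_one] at h'
    have hα : ((k : ℝ) - 2) * α ≤ 1 := by
      rwa [le_div_iff₀' (by linarith)] at hα2
    have hB : 0 ≤ (k : ℝ) * α * (2 * k - n - 2) + n := by
      rcases le_total 0 (2 * (k : ℝ) - n - 2) with h | h
      · have := mul_nonneg (zero_le_one.trans ha1) h
        linarith
      · have h' := mul_nonneg (mul_nonneg hk0.le (neg_nonneg.2 h)) (sub_nonneg.2 hα)
        refine nonneg_of_mul_nonneg_right (a := (k : ℝ) - 2) ?_ (by linarith)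
        nlinarith
    have hx := mul_nonneg (mul_nonneg hk0.le (sub_nonneg.2 hα)) (sq_nonneg l1)
    have hxy := mul_nonneg (mul_nonneg hB h1.le) h2.le
    have hy := mul_nonneg (mul_nonneg (sub_nonneg.2 hknR) (by linarith : 0 ≤ 1 + (k : ℝ) * α))
      (sq_nonneg l2)
    linarith
end

section
/- For all integers 1 ≤ k ≤ n and all real x, Q(x, k, n, 1/k) = −2·(n + (x−1)(k+x))³. Consequently, for all real x > 0, Q(x, k, n, 1/k) < 0. -/
/-- The sextic polynomial `Q(x,k,n,α)` from the paper. -/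
def Q (x k n α : ℝ) : ℝ :=
  k ^ 2 * (α * (k - 1) - 1) * (α * (k + 2) - 1) * x ^ 6
  + k * (α ^ 2 * k * (-4 * k ^ 2 + 3 * k * (n - 2) + n + 6)
      + α * (10 * k ^ 2 - 6 * k * n - n) + 3 * n - 6 * k) * x ^ 5
  + (α ^ 2 * k ^ 2 * (6 * k ^ 2 + 3 * k * (4 - 3 * n) + 2 * n ^ 2 - 5 * n - 6)
      + α * k * (k ^ 3 - 24 * k ^ 2 + 2 * k * (11 * n + 3) - n * (4 * n + 1))
      - k ^ 3 + 12 * k ^ 2 - 13 * k * n + 2 * n ^ 2) * x ^ 4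
  + (α ^ 2 * k ^ 2 * (-4 * k ^ 2 + k * (9 * n - 10) - 4 * n ^ 2 + 7 * n + 2)
      + α * k * (-4 * k ^ 3 + k ^ 2 * (3 * n + 32) - 2 * k * (19 * n + 4)
          + 5 * n * (2 * n + 1))
      + 2 * k ^ 3 - k ^ 2 * (3 * n + 10) + 17 * k * n - 6 * n ^ 2) * x ^ 3
  + (k - n) * (α ^ 2 * k ^ 2 * (k - 2 * n + 3)
      + α * k * (6 * k ^ 2 - k * (3 * n + 22) + 12 * n + 3)
      + 3 * k * (n + 1) - 4 * n) * x ^ 2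
  + (n - k) ^ 2 * (-α * k * (4 * k - n - 6) - 2 * k - n) * x
  + (α * k + 1) * (k - n) ^ 3

theorem Q_at_one_div_k (k n : ℕ) (hk : 1 ≤ k) (hkn : k ≤ n) :
    (∀ x : ℝ, Q x k n (1 / (k : ℝ))
        = -2 * ((n : ℝ) + (x - 1) * ((k : ℝ) + x)) ^ 3) ∧
    ∀ x : ℝ, 0 < x → Q x k n (1 / (k : ℝ)) < 0 := by
  have hk0 : (k : ℝ) ≠ 0 := by positivity
  have heq : ∀ x : ℝ, Q x k n (1 / (k : ℝ))
      = -2 * ((n : ℝ) + (x - 1) * ((k : ℝ) + x)) ^ 3 := by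
    intro x
    unfold Q
    field_simp
    ring
  refine ⟨heq, fun x hx => ?_⟩
  have hk1 : (1 : ℝ) ≤ k := by exact_mod_cast hk
  have hkn' : (k : ℝ) ≤ n := by exact_mod_cast hkn
  have hpos : 0 < (n : ℝ) + (x - 1) * ((k : ℝ) + x) := by
    nlinarith [mul_nonneg (sub_nonneg.2 hk1) hx.le, mul_pos hx hx]
  rw [heq]
  linarith [pow_pos hpos 3]
end

section
/- For all integers n ≥ 3 and 1 ≤ k ≤ n and every fixed real x ≥ 0, the function α ↦ Q(x, k, n, α) is convex on ℝ. (Indeed, the coefficient of α² in Q(x,k,n,α) equals k²x²(x−1)²·((k²+k−2)x² + (n(3k+1)−2k²−4k+2)x + (n−k)(2n−k−3)), which is nonnegative for x ≥ 0.) -/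
/-- A real quadratic with nonnegative leading coefficient is convex. -/
theorem convexOn_quadratic {a : ℝ} (ha : 0 ≤ a) (b c : ℝ) :
    ConvexOn ℝ Set.univ (fun t : ℝ => a * t ^ 2 + b * t + c) := by
  refine ⟨convex_univ, fun t _ u _ p q hp hq hpq => ?_⟩
  have h : 0 ≤ p * q * a * (t - u) ^ 2 := by positivity
  obtain rfl : q = 1 - p := by linarith
  simp only [smul_eq_mul]
  linarith

/-- The coefficient of `α ^ 2` in `Q x k n α`. -/
def Qlead (x k n : ℝ) : ℝ :=
  k ^ 2 * x ^ 2 * (x - 1) ^ 2 * ((k ^ 2 + k - 2) * x ^ 2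
    + (n * (3 * k + 1) - 2 * k ^ 2 - 4 * k + 2) * x + (n - k) * (2 * n - k - 3))

theorem Q_eq_quadratic (x k n α : ℝ) :
    Q x k n α = Qlead x k n * α ^ 2 + (Q x k n 1 - Q x k n (-1)) / 2 * α + Q x k n 0 := by
  simp only [Q, Qlead]
  ring

theorem Qlead_nonneg {n k : ℕ} (hn : 3 ≤ n) (hk : 1 ≤ k) (hkn : k ≤ n) {x : ℝ} (hx : 0 ≤ x) :
    0 ≤ Qlead x k n := by
  have hn' : (3 : ℝ) ≤ n := by exact_mod_cast hn
  have hk' : (1 : ℝ) ≤ k := by exact_mod_cast hk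
  have hkn' : (k : ℝ) ≤ n := by exact_mod_cast hkn
  have hquad : (0 : ℝ) ≤ k ^ 2 + k - 2 := by nlinarith
  have hlin : (0 : ℝ) ≤ n * (3 * k + 1) - 2 * k ^ 2 - 4 * k + 2 := by
    have hint : (0 : ℝ) ≤ (k - 1) * (k - 2) := by
      rcases hk.eq_or_lt with rfl | h
      · norm_num
      · have : (2 : ℝ) ≤ k := by exact_mod_cast h
        exact mul_nonneg (by linarith) (by linarith)
    nlinarith [mul_nonneg (sub_nonneg.2 hkn') (by positivity : (0 : ℝ) ≤ 3 * k + 1)]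
  have hconst : (0 : ℝ) ≤ (n - k) * (2 * n - k - 3) :=
    mul_nonneg (by linarith) (by linarith)
  unfold Qlead
  positivity

theorem Q_convexOn_in_alpha (n k : ℕ) (hn : 3 ≤ n) (hk : 1 ≤ k) (hkn : k ≤ n)
    (x : ℝ) (hx : 0 ≤ x) :
    ConvexOn ℝ Set.univ (fun α : ℝ => Q x k n α) := by
  rw [funext (Q_eq_quadratic x k n)]
  exact convexOn_quadratic (Qlead_nonneg hn hk hkn hx) _ _
end

section
/- For all integers n ≥ 3 and 1 ≤ k ≤ n, there exists a real constant c > 1/k such that for every α with 1/k ≤ α ≤ c and every real x > 0, Q(x, k, n, α) ≤ 0. -/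
/-- The quadratic whose cube, times `-2`, is the value of `Q` at `α = 1 / k`. -/
def baseQuadratic (x k n : ℝ) : ℝ :=
  x ^ 2 + (k - 1) * x + (n - k)

/-- Expansion of `Q` in powers of `α * k - 1`. -/
lemma Q_eq_expansion (x k n α : ℝ) :
    Q x k n α = -2 * baseQuadratic x k n ^ 3
      + (α * k - 1) * ((k - 4) + (α * k - 1) * (k ^ 2 + k - 2)) * x ^ 6
      + (α * k - 1) * ((2 * k ^ 2 - 12 * k + n + 12)
          + (α * k - 1) * (-4 * k ^ 2 + 3 * k * n - 6 * k + n + 6)) * x ^ 5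
      + (α * k - 1) * ((k ^ 3 - 12 * k ^ 2 + 4 * k * n + 30 * k - 11 * n - 12)
          + (α * k - 1) * (6 * k ^ 2 + 12 * k - 9 * k * n + 2 * n ^ 2 - 5 * n - 6)) * x ^ 4
      + (α * k - 1) * ((-4 * k ^ 3 + 3 * n * k ^ 2 + 24 * k ^ 2 - 20 * k * n - 28 * k
            + 2 * n ^ 2 + 19 * n + 4)
          + (α * k - 1) * (-4 * k ^ 2 + 9 * k * n - 10 * k - 4 * n ^ 2 + 7 * n + 2)) * x ^ 3
      + (α * k - 1) * (-(6 * k ^ 2 - 3 * k * n - 20 * k + 8 * n + 9)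
          + (α * k - 1) * (-(k - 2 * n + 3))) * ((n - k) * x ^ 2)
      + (α * k - 1) * ((n - k) * -(4 * k - n - 6) + (α * k - 1) * 0) * ((n - k) * x)
      + (α * k - 1) * (-(n - k) ^ 2 + (α * k - 1) * 0) * ((n - k) * 1) := by
  unfold Q baseQuadratic
  ring

lemma perturbation_term_le {ε r s m T : ℝ} (hε : 0 ≤ ε) (hε1 : ε ≤ 1) (hm : 0 ≤ m)
    (hmT : m ≤ T) : ε * (r + ε * s) * m ≤ ε * ((|r| + |s|) * T) := by
  have hs : ε * s ≤ |s| :=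
    (mul_le_mul_of_nonneg_left (le_abs_self s) hε).trans
      (mul_le_of_le_one_left (abs_nonneg s) hε1)
  have hrs : r + ε * s ≤ |r| + |s| := add_le_add (le_abs_self r) hs
  rw [mul_assoc]
  gcongr

/-- Monomials are dominated by the cube of any quantity dominating `x` and `x ^ 2`. -/
lemma pow_le_cube {x p : ℝ} (hx : 0 ≤ x) (h1 : x ≤ p) (h2 : x ^ 2 ≤ p) :
    x ^ 3 ≤ p ^ 3 ∧ x ^ 4 ≤ p ^ 3 ∧ x ^ 5 ≤ p ^ 3 ∧ x ^ 6 ≤ p ^ 3 := by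
  have hp : 0 ≤ p := hx.trans h1
  refine ⟨by gcongr, ?_, ?_, ?_⟩
  · calc x ^ 4 = x * x * x ^ 2 := by ring
      _ ≤ p * p * p := by gcongr
      _ = p ^ 3 := by ring
  · calc x ^ 5 = x * x ^ 2 * x ^ 2 := by ring
      _ ≤ p * p * p := by gcongr
      _ = p ^ 3 := by ring
  · calc x ^ 6 = x ^ 2 * x ^ 2 * x ^ 2 := by ring
      _ ≤ p * p * p := by gcongr
      _ = p ^ 3 := by ring

/-- A perturbation `∑ i, ε * (r i + ε * s i) * m i` with weights `m i` of size `O(T)` is at most `T`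
for all sufficiently small `ε ≥ 0`. -/
lemma exists_pos_forall_perturbation_le {ι : Type*} [Fintype ι] (r s : ι → ℝ) {C : ℝ}
    (hC : 0 ≤ C) :
    ∃ δ : ℝ, 0 < δ ∧ ∀ ε : ℝ, 0 ≤ ε → ε ≤ δ → ∀ (m : ι → ℝ) (T : ℝ), 0 ≤ T →
      (∀ i, 0 ≤ m i) → (∀ i, m i ≤ C * T) → ∑ i, ε * (r i + ε * s i) * m i ≤ T := by
  set A : ℝ := (∑ i, (|r i| + |s i|)) * C
  have hA : 0 ≤ A := by positivity
  refine ⟨1 / (A + 1), by positivity, fun ε hε hεδ m T hT hm hmT => ?_⟩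
  have hεA : ε * (A + 1) ≤ 1 := (le_div_iff₀ (by positivity)).mp hεδ
  have hε1 : ε ≤ 1 := by nlinarith
  calc ∑ i, ε * (r i + ε * s i) * m i
      ≤ ∑ i, ε * ((|r i| + |s i|) * (C * T)) :=
        Finset.sum_le_sum fun i _ => perturbation_term_le hε hε1 (hm i) (hmT i)
    _ = ε * A * T := by
        rw [← Finset.mul_sum, ← Finset.sum_mul]
        ring
    _ ≤ 1 * T := by
        gcongr
        linarith
    _ = T := one_mul T

/-- For `x > 0`, all monomials of degree three to six, and also those of lower degree unless
`k = n`, are dominated by the cube of the quadratic. -/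
lemma monomials_le_baseQuadratic_cube {n k : ℕ} (hn : 3 ≤ n) (hk : 1 ≤ k) (hkn : k ≤ n) {x : ℝ}
    (hx : 0 < x) (i : Fin 7) :
    (![x ^ 6, x ^ 5, x ^ 4, x ^ 3, (n - k) * x ^ 2, (n - k) * x, (n - k) * 1] : Fin 7 → ℝ) i
      ≤ n * baseQuadratic x k n ^ 3 := by
  have hk' : (1 : ℝ) ≤ k := by exact_mod_cast hk
  have hn' : (3 : ℝ) ≤ n := by exact_mod_cast hn
  have hkx : 0 ≤ ((k : ℝ) - 1) * x := mul_nonneg (by linarith) hx.le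
  rcases hkn.eq_or_lt with rfl | hlt
  · have h1 : x ≤ baseQuadratic x k k := by
      unfold baseQuadratic
      nlinarith
    have h2 : x ^ 2 ≤ baseQuadratic x k k := by
      unfold baseQuadratic
      linarith
    obtain ⟨h3, h4, h5, h6⟩ := pow_le_cube hx.le h1 h2
    have hT : 0 ≤ baseQuadratic x k k ^ 3 := (by positivity : 0 ≤ x ^ 3).trans h3
    have hnT := le_mul_of_one_le_left hT hk'
    fin_cases i <;> simp <;> linarith
  · have hlt' : (k : ℝ) + 1 ≤ n := by exact_mod_cast hlt
    have h2 : x ^ 2 ≤ baseQuadratic x k n := by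
      unfold baseQuadratic
      linarith
    have h0 : 1 ≤ baseQuadratic x k n := by
      unfold baseQuadratic
      nlinarith
    have h1 : x ≤ baseQuadratic x k n := by nlinarith [sq_nonneg (x - 1)]
    obtain ⟨h3, h4, h5, h6⟩ := pow_le_cube hx.le h1 h2
    have hT : 1 ≤ baseQuadratic x k n ^ 3 := one_le_pow₀ h0
    have hpT : baseQuadratic x k n ≤ baseQuadratic x k n ^ 3 := le_self_pow₀ h0 (by norm_num)
    have hnT := le_mul_of_one_le_left (by linarith : 0 ≤ baseQuadratic x k n ^ 3)
      (by linarith : (1 : ℝ) ≤ n)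
    have hlow : ∀ y : ℝ, 0 ≤ y → y ≤ baseQuadratic x k n ^ 3 →
        ((n : ℝ) - k) * y ≤ n * baseQuadratic x k n ^ 3 := fun y hy hyT => by
      have : (n : ℝ) - k ≤ n := by linarith
      gcongr
    have l2 := hlow (x ^ 2) (by positivity) (h2.trans hpT)
    have l1 := hlow x hx.le (h1.trans hpT)
    have l0 := hlow 1 zero_le_one hT
    fin_cases i <;> simp <;> linarith

theorem exists_c0_Q_nonpos (n k : ℕ) (hn : 3 ≤ n) (hk : 1 ≤ k) (hkn : k ≤ n) :
    ∃ c : ℝ, 1 / (k : ℝ) < c ∧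
      ∀ α : ℝ, 1 / (k : ℝ) ≤ α → α ≤ c →
        ∀ x : ℝ, 0 < x → Q x k n α ≤ 0 := by
  have hk' : (0 : ℝ) < k := by exact_mod_cast hk
  have hnk : (0 : ℝ) ≤ (n : ℝ) - k := sub_nonneg.mpr (by exact_mod_cast hkn)
  obtain ⟨δ, hδ, hsum⟩ := exists_pos_forall_perturbation_le
    (![(k : ℝ) - 4,
      2 * k ^ 2 - 12 * k + n + 12,
      k ^ 3 - 12 * k ^ 2 + 4 * k * n + 30 * k - 11 * n - 12,
      -4 * k ^ 3 + 3 * n * k ^ 2 + 24 * k ^ 2 - 20 * k * n - 28 * k + 2 * n ^ 2 + 19 * n + 4,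
      -(6 * k ^ 2 - 3 * k * n - 20 * k + 8 * n + 9),
      (n - k) * -(4 * k - n - 6),
      -(n - k) ^ 2] : Fin 7 → ℝ)
    (![(k : ℝ) ^ 2 + k - 2,
      -4 * k ^ 2 + 3 * k * n - 6 * k + n + 6,
      6 * k ^ 2 + 12 * k - 9 * k * n + 2 * n ^ 2 - 5 * n - 6,
      -4 * k ^ 2 + 9 * k * n - 10 * k - 4 * n ^ 2 + 7 * n + 2,
      -(k - 2 * n + 3),
      0,
      0] : Fin 7 → ℝ)
    (Nat.cast_nonneg n : (0 : ℝ) ≤ n)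
  refine ⟨(1 + δ) / k, by gcongr; linarith, fun α hα hαc x hx => ?_⟩
  have hε : 0 ≤ α * k - 1 := sub_nonneg.mpr ((div_le_iff₀ hk').mp hα)
  have hεδ : α * k - 1 ≤ δ := by linarith [(le_div_iff₀ hk').mp hαc]
  have hk1 : (0 : ℝ) ≤ (k : ℝ) - 1 := sub_nonneg.mpr (by exact_mod_cast hk)
  have hT : 0 ≤ baseQuadratic x k n ^ 3 := by
    unfold baseQuadratic
    positivity
  have hle := hsum _ hε hεδ
    ![x ^ 6, x ^ 5, x ^ 4, x ^ 3, (n - k) * x ^ 2, (n - k) * x, (n - k) * 1]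
    (baseQuadratic x k n ^ 3) hT
    (fun i => by fin_cases i <;> simp <;> first | positivity | linarith)
    (monomials_le_baseQuadratic_cube hn hk hkn hx)
  rw [Q_eq_expansion]
  simp only [Fin.sum_univ_seven, Matrix.cons_val] at hle
  linarith
end

section
/- For every integer n ≥ 3 and every real x > 0, Q(x, 1, n, 1 + 7/n) ≤ 0. -/
/-- Decomposition of `Q` at `k = 1` in powers of `α - 1`. -/
lemma Q_one_eq (x n d : ℝ) :
    Q x 1 n (1 + d) = -2 * (x ^ 2 + (n - 1)) ^ 3
      + d * (x ^ 2 + (n - 1)) ^ 2 * ((n + 2) * x - 3 * x ^ 2 - (n - 1))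
      + 2 * (n - 1) * d ^ 2 * x ^ 2 * (x - 1) ^ 2 * (2 * x + n - 2) := by
  unfold Q
  ring

/-- The polynomial `-n² Q(x, 1, n, 1 + 7/n)`, expanded in powers of `n - 3`, has coefficients
that are nonnegative in `x`. -/
lemma neg_sq_mul_Q_one_nonneg {n x : ℝ} (hn : 3 ≤ n) (hx : 0 < x) :
    0 ≤ 2 * n ^ 2 * (x ^ 2 + (n - 1)) ^ 3
      - 7 * n * (x ^ 2 + (n - 1)) ^ 2 * ((n + 2) * x - 3 * x ^ 2 - (n - 1))
      - 98 * (n - 1) * x ^ 2 * (x - 1) ^ 2 * (2 * x + n - 2) := by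
  obtain ⟨s, rfl⟩ : ∃ s, n = s + 3 := ⟨n - 3, by ring⟩
  have hs : 0 ≤ s := by linarith
  have h0 : 0 ≤ 81 * x ^ 6 - 497 * x ^ 5 + 990 * x ^ 4 - 420 * x ^ 3 + 440 * x ^ 2
      - 420 * x + 312 := by
    nlinarith [sq_nonneg (x ^ 2 * (x - 497 / 162)), sq_nonneg (x * (x - 210 / 227)),
      sq_nonneg (x - 210 / 246), sq_nonneg (x ^ 2), sq_nonneg x]
  have h1 : 0 ≤ 33 * x ^ 6 - 252 * x ^ 5 + 469 * x ^ 4 - 42 * x ^ 3 + 626 * x ^ 2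
      - 644 * x + 620 := by
    nlinarith [sq_nonneg (x * (x ^ 2 - 42 / 11 * x - 1 / 2)), sq_nonneg (x * (x - 4)),
      sq_nonneg (x - 322 / 279), sq_nonneg (x ^ 2), sq_nonneg x]
  have h2 : 0 ≤ 2 * x ^ 6 - 7 * x ^ 5 - x ^ 4 + 56 * x ^ 3 + 369 * x ^ 2 - 357 * x + 478 := by
    nlinarith [sq_nonneg (x ^ 2 * (x - 7 / 4)), sq_nonneg (x * (x ^ 2 - 7 / 4 * x - 3)),
      sq_nonneg (x - 1 / 2), sq_nonneg (x ^ 2), sq_nonneg x, pow_pos hx 3]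
  have h3 : 0 ≤ 6 * x ^ 4 - 14 * x ^ 3 + 95 * x ^ 2 - 84 * x + 177 := by
    nlinarith [sq_nonneg (x * (x - 7 / 6)), sq_nonneg (x - 1 / 2), sq_nonneg x]
  have h4 : 0 ≤ 6 * x ^ 2 - 7 * x + 31 := by
    nlinarith [sq_nonneg (x - 7 / 12)]
  have key : 0 ≤ (81 * x ^ 6 - 497 * x ^ 5 + 990 * x ^ 4 - 420 * x ^ 3 + 440 * x ^ 2
        - 420 * x + 312)
      + s * (33 * x ^ 6 - 252 * x ^ 5 + 469 * x ^ 4 - 42 * x ^ 3 + 626 * x ^ 2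
        - 644 * x + 620)
      + s ^ 2 * (2 * x ^ 6 - 7 * x ^ 5 - x ^ 4 + 56 * x ^ 3 + 369 * x ^ 2 - 357 * x + 478)
      + s ^ 3 * (6 * x ^ 4 - 14 * x ^ 3 + 95 * x ^ 2 - 84 * x + 177)
      + s ^ 4 * (6 * x ^ 2 - 7 * x + 31) + 2 * s ^ 5 := by
    positivity
  refine key.trans_eq ?_
  ring

theorem Q_nonpos_k_one (n : ℕ) (hn : 3 ≤ n) (x : ℝ) (hx : 0 < x) :
    Q x 1 n (1 + 7 / (n : ℝ)) ≤ 0 := by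
  have hn' : (3 : ℝ) ≤ n := by exact_mod_cast hn
  have hpos : (0 : ℝ) < n := by linarith
  refine nonpos_of_neg_nonneg
    ((div_nonneg (neg_sq_mul_Q_one_nonneg hn' hx) (sq_nonneg (n : ℝ))).trans_eq ?_)
  rw [Q_one_eq]
  field_simp
  ring
end

section
/- For all integers k ≥ 2 and n ≥ k² and every real x > 0, Q(x, k, n, 1/k + k/((k−1)n)) ≤ 0. -/
/-- The coefficient of `x ^ 0` in `s ^ 2 * Q x k n (b / (k * s))`. -/
def Q.coeff_zero (k n b s : ℝ) : ℝ :=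
  (b * s + s ^ 2) * (k - n) ^ 3

/-- The coefficient of `x ^ 1` in `s ^ 2 * Q x k n (b / (k * s))`. -/
def Q.coeff_one (k n b s : ℝ) : ℝ :=
  (n - k) ^ 2 * (-(b * s) * (4 * k - n - 6) - s ^ 2 * (2 * k + n))

/-- The coefficient of `x ^ 2` in `s ^ 2 * Q x k n (b / (k * s))`. -/
def Q.coeff_two (k n b s : ℝ) : ℝ :=
  (k - n) * (b ^ 2 * (k - 2 * n + 3)
    + b * s * (6 * k ^ 2 - k * (3 * n + 22) + 12 * n + 3)
    + s ^ 2 * (3 * k * (n + 1) - 4 * n))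

/-- The coefficient of `x ^ 3` in `s ^ 2 * Q x k n (b / (k * s))`. -/
def Q.coeff_three (k n b s : ℝ) : ℝ :=
  b ^ 2 * (-4 * k ^ 2 + k * (9 * n - 10) - 4 * n ^ 2 + 7 * n + 2)
    + b * s * (-4 * k ^ 3 + k ^ 2 * (3 * n + 32) - 2 * k * (19 * n + 4)
        + 5 * n * (2 * n + 1))
    + s ^ 2 * (2 * k ^ 3 - k ^ 2 * (3 * n + 10) + 17 * k * n - 6 * n ^ 2)

/-- The coefficient of `x ^ 4` in `s ^ 2 * Q x k n (b / (k * s))`. -/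
def Q.coeff_four (k n b s : ℝ) : ℝ :=
  b ^ 2 * (6 * k ^ 2 + 3 * k * (4 - 3 * n) + 2 * n ^ 2 - 5 * n - 6)
    + b * s * (k ^ 3 - 24 * k ^ 2 + 2 * k * (11 * n + 3) - n * (4 * n + 1))
    + s ^ 2 * (-k ^ 3 + 12 * k ^ 2 - 13 * k * n + 2 * n ^ 2)

/-- The coefficient of `x ^ 5` in `s ^ 2 * Q x k n (b / (k * s))`. -/
def Q.coeff_five (k n b s : ℝ) : ℝ :=
  b ^ 2 * (-4 * k ^ 2 + 3 * k * (n - 2) + n + 6)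
    + b * s * (10 * k ^ 2 - 6 * k * n - n) + s ^ 2 * (k * (3 * n - 6 * k))

/-- The coefficient of `x ^ 6` in `s ^ 2 * Q x k n (b / (k * s))`. -/
def Q.coeff_six (k b s : ℝ) : ℝ :=
  (b * (k - 1) - k * s) * (b * (k + 2) - k * s)

lemma Q.sq_mul_eq (x k n α b s : ℝ) (hb : α * k * s = b) :
    s ^ 2 * Q x k n α =
      coeff_six k b s * x ^ 6 + coeff_five k n b s * x ^ 5 + coeff_four k n b s * x ^ 4
        + coeff_three k n b s * x ^ 3 + coeff_two k n b s * x ^ 2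
        + coeff_one k n b s * x + coeff_zero k n b s := by
  subst hb
  simp only [Q, coeff_zero, coeff_one, coeff_two, coeff_three, coeff_four, coeff_five, coeff_six]
  ring

lemma exists_eq_add_two_of_sq_le {k n : ℝ} (hk : 2 ≤ k) (hn : k ^ 2 ≤ n) :
    ∃ a m : ℝ, 0 ≤ a ∧ 0 ≤ m ∧ k = a + 2 ∧ n = (a + 2) ^ 2 + m :=
  ⟨k - 2, n - k ^ 2, by linarith, by linarith, by ring, by ring⟩

lemma Q.coeff_zero_nonpos {k n : ℝ} (hk : 2 ≤ k) (hn : k ^ 2 ≤ n) :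
    coeff_zero k n ((k - 1) * n + k ^ 2) ((k - 1) * n) ≤ 0 := by
  obtain ⟨a, m, ha, hm, rfl, rfl⟩ := exists_eq_add_two_of_sq_le hk hn
  rw [← neg_nonneg]
  simp only [coeff_zero]
  ring_nf
  positivity

lemma Q.coeff_one_nonpos {k n : ℝ} (hk : 2 ≤ k) (hn : k ^ 2 ≤ n) :
    coeff_one k n ((k - 1) * n + k ^ 2) ((k - 1) * n) ≤ 0 := by
  obtain ⟨a, m, ha, hm, rfl, rfl⟩ := exists_eq_add_two_of_sq_le hk hn
  rw [← neg_nonneg]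
  simp only [coeff_one]
  ring_nf
  positivity

lemma Q.coeff_two_nonpos {k n : ℝ} (hk : 2 ≤ k) (hn : k ^ 2 ≤ n) :
    coeff_two k n ((k - 1) * n + k ^ 2) ((k - 1) * n) ≤ 0 := by
  obtain ⟨a, m, ha, hm, rfl, rfl⟩ := exists_eq_add_two_of_sq_le hk hn
  rw [← neg_nonneg]
  simp only [coeff_two]
  ring_nf
  positivity

lemma Q.coeff_three_nonpos {k n : ℝ} (hk : 2 ≤ k) (hn : k ^ 2 ≤ n) :
    coeff_three k n ((k - 1) * n + k ^ 2) ((k - 1) * n) ≤ 0 := by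
  obtain ⟨a, m, ha, hm, rfl, rfl⟩ := exists_eq_add_two_of_sq_le hk hn
  rw [← neg_nonneg]
  simp only [coeff_three]
  ring_nf
  positivity

lemma Q.coeff_four_nonpos {k n : ℝ} (hk : 2 ≤ k) (hn : k ^ 2 ≤ n) :
    coeff_four k n ((k - 1) * n + k ^ 2) ((k - 1) * n) ≤ 0 := by
  obtain ⟨a, m, ha, hm, rfl, rfl⟩ := exists_eq_add_two_of_sq_le hk hn
  rw [← neg_nonneg]
  simp only [coeff_four]
  ring_nf
  positivity

lemma Q.coeff_six_nonpos {k n : ℝ} (hk : 2 ≤ k) (hn : k ^ 2 ≤ n) :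
    coeff_six k ((k - 1) * n + k ^ 2) ((k - 1) * n) ≤ 0 := by
  obtain ⟨a, m, ha, hm, rfl, rfl⟩ := exists_eq_add_two_of_sq_le hk hn
  rw [← neg_nonneg]
  simp only [coeff_six]
  ring_nf
  positivity

lemma Q.coeff_four_add_coeff_five_nonpos {k n : ℝ} (hk : 2 ≤ k) (hn : k ^ 2 ≤ n) :
    coeff_four k n ((k - 1) * n + k ^ 2) ((k - 1) * n)
      + coeff_five k n ((k - 1) * n + k ^ 2) ((k - 1) * n) ≤ 0 := by
  obtain ⟨a, m, ha, hm, rfl, rfl⟩ := exists_eq_add_two_of_sq_le hk hn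
  rw [← neg_nonneg]
  simp only [coeff_four, coeff_five]
  ring_nf
  positivity

lemma Q.four_mul_coeff_six_add_coeff_five_nonpos {k n : ℝ} (hk : 2 ≤ k) (hn : k ^ 2 ≤ n) :
    4 * coeff_six k ((k - 1) * n + k ^ 2) ((k - 1) * n)
      + coeff_five k n ((k - 1) * n + k ^ 2) ((k - 1) * n) ≤ 0 := by
  obtain ⟨a, m, ha, hm, rfl, rfl⟩ := exists_eq_add_two_of_sq_le hk hn
  rw [← neg_nonneg]
  simp only [coeff_six, coeff_five]
  ring_nf
  positivity

/-- If `c + b ≤ 0` and `4 * a + b ≤ 0`, the bound `x ≤ 1 + x ^ 2 / 4` absorbs the linear term. -/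
lemma quadratic_nonpos_of_add_nonpos {a b c x : ℝ} (hx : 0 ≤ x) (ha : a ≤ 0) (hc : c ≤ 0)
    (hcb : c + b ≤ 0) (hab : 4 * a + b ≤ 0) : a * x ^ 2 + b * x + c ≤ 0 := by
  rcases le_total b 0 with hb | hb
  · nlinarith [mul_nonneg hx (neg_nonneg.2 hb), mul_nonneg (sq_nonneg x) (neg_nonneg.2 ha)]
  · nlinarith [mul_nonneg hb (sq_nonneg (x - 2)), mul_nonneg (sq_nonneg x) (neg_nonneg.2 hab)]

theorem Q_nonpos_of_k_ge_two (k n : ℕ) (hk : 2 ≤ k) (hn : k ^ 2 ≤ n)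
    (x : ℝ) (hx : 0 < x) :
    Q x k n (1 / (k : ℝ) + (k : ℝ) / (((k : ℝ) - 1) * n)) ≤ 0 := by
  have hk' : (2 : ℝ) ≤ k := by exact_mod_cast hk
  have hn' : (k : ℝ) ^ 2 ≤ n := by exact_mod_cast hn
  have hn_pos : (0 : ℝ) < n := by nlinarith
  have hk_pos : (0 : ℝ) < (k : ℝ) - 1 := by linarith
  have hs : 0 < ((k : ℝ) - 1) * n := mul_pos hk_pos hn_pos
  have hb : (1 / (k : ℝ) + (k : ℝ) / (((k : ℝ) - 1) * n)) * k * (((k : ℝ) - 1) * n)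
      = ((k : ℝ) - 1) * n + (k : ℝ) ^ 2 := by
    field_simp
  refine nonpos_of_mul_nonpos_right ?_ (pow_pos hs 2)
  rw [Q.sq_mul_eq x k n _ _ _ hb]
  have h_top := mul_nonpos_of_nonneg_of_nonpos (pow_nonneg hx.le 4)
    (quadratic_nonpos_of_add_nonpos hx.le (Q.coeff_six_nonpos hk' hn')
      (Q.coeff_four_nonpos hk' hn') (Q.coeff_four_add_coeff_five_nonpos hk' hn')
      (Q.four_mul_coeff_six_add_coeff_five_nonpos hk' hn'))
  have h_three := mul_nonpos_of_nonpos_of_nonneg (Q.coeff_three_nonpos hk' hn')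
    (pow_nonneg hx.le 3)
  have h_two := mul_nonpos_of_nonpos_of_nonneg (Q.coeff_two_nonpos hk' hn')
    (pow_nonneg hx.le 2)
  have h_one := mul_nonpos_of_nonpos_of_nonneg (Q.coeff_one_nonpos hk' hn') hx.le
  have h_zero := Q.coeff_zero_nonpos hk' hn'
  linarith
end

section
/- For all integers k ≥ 2 and n ≥ k², one has (4√(n(n−k)(n+2−2k)) − 2k(n+2) + n(6+n)) / (k(n−2)²) ≥ 1/k + k/((k−1)n). (That is, the constant c₂(n,k) = (4√(n(n−k)(n+2−2k)) − 2k(n+2) + n(6+n))/(k(n−2)²), which applies since n ≥ k² > k(k−1), satisfies c₂(n,k) ≥ 1/k + k/((k−1)n).) -/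
theorem c2_n_k_ge (k n : ℕ) (hk : 2 ≤ k) (hn : k ^ 2 ≤ n) :
    (4 * Real.sqrt ((n : ℝ) * ((n : ℝ) - k) * ((n : ℝ) + 2 - 2 * k))
        - 2 * (k : ℝ) * ((n : ℝ) + 2) + (n : ℝ) * (6 + n))
        / ((k : ℝ) * ((n : ℝ) - 2) ^ 2)
      ≥ 1 / (k : ℝ) + (k : ℝ) / (((k : ℝ) - 1) * n) := by
  have hk' : (2 : ℝ) ≤ k := by exact_mod_cast hk
  have hn' : (k : ℝ) ^ 2 ≤ n := by exact_mod_cast hn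
  generalize (k : ℝ) = x at *
  generalize (n : ℝ) = y at *
  have hy : 4 ≤ y := by nlinarith
  have hb : 0 ≤ y + 2 - 2 * x := by nlinarith
  have hsqrt : x * (y + 2 - 2 * x) ≤ √(y * (y - x) * (y + 2 - 2 * x)) := by
    apply Real.le_sqrt_of_sq_le
    have hle : x ^ 2 * (y + 2 - 2 * x) ≤ y * (y - x) :=
      mul_le_mul hn' (by linarith) hb (by linarith)
    nlinarith [mul_le_mul_of_nonneg_right hle hb]
  have hfrac : x ^ 2 * (y - 2) ^ 2 / ((x - 1) * y) ≤ (x + 2) * (y - 3) := by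
    rw [div_le_iff₀ (mul_pos (by linarith) (by linarith))]
    have hx : x ^ 2 ≤ (x + 2) * (x - 1) := by nlinarith
    have hy' : (y - 2) ^ 2 ≤ (y - 3) * y := by nlinarith
    nlinarith [mul_le_mul hx hy' (sq_nonneg _) ((sq_nonneg x).trans hx)]
  have hx0 : x ≠ 0 := by linarith
  have hx1 : x - 1 ≠ 0 := by linarith
  have hy0 : y ≠ 0 := by linarith
  have hrhs : (1 / x + x / ((x - 1) * y)) * (x * (y - 2) ^ 2)
      = (y - 2) ^ 2 + x ^ 2 * (y - 2) ^ 2 / ((x - 1) * y) := by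
    field_simp
  rw [ge_iff_le, le_div_iff₀ (mul_pos (by linarith) (pow_pos (by linarith) 2)), hrhs]
  nlinarith [mul_nonneg (sub_nonneg.2 hk') (sub_nonneg.2 hn')]
end
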